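/- For n ≥ 3, the number τ(P_2 □ C_n) of minimum dominating sets of P_2 □ C_n equals: 4 if n ≡ 0 (mod 4); 2n if n ≡ 1 or 3 (mod 4) and n ≠ 3; n(n+2) if n ≡ 2 (mod 4) and n ≠ 6; 9 if n = 3; and 51 if n = 6. -/

import Mathlib

open SimpleGraph Finset
open scoped Classical

/-- `D` is a dominating set of `G`: every vertex not in `D` is adjacent to a vertex in `D`. -/
def isDomSet {V : Type*} (G : SimpleGraph V) (D : Finset V) : Prop :=
  ∀ v : V, v ∉ D → ∃ u ∈ D, G.Adj u v

/-- The domination number `γ(G)`: minimum cardinality of a dominating set of `G`. -/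
noncomputable def domNum {V : Type*} [Fintype V] (G : SimpleGraph V) : ℕ :=
  sInf {n | ∃ D : Finset V, isDomSet G D ∧ D.card = n}

/-- The collection of minimum dominating sets (`γ(G)`-sets) of `G`. -/
noncomputable def gammaSets {V : Type*} [Fintype V] (G : SimpleGraph V) : Finset (Finset V) :=
  Finset.univ.filter (fun D => isDomSet G D ∧ D.card = domNum G)

/-- `τ(G)`: the total number of `γ(G)`-sets. -/
noncomputable def tau {V : Type*} [Fintype V] (G : SimpleGraph V) : ℕ :=
  (gammaSets G).card

/-- The domination value `DV_G(v)`: the number of `γ(G)`-sets containing `v`. -/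
noncomputable def DV {V : Type*} [Fintype V] (G : SimpleGraph V) (v : V) : ℕ :=
  ((gammaSets G).filter (fun D => v ∈ D)).card

/-- The sum over all paths of length `n` of the products of the entries of `M` along the path,
weighted by a function of the two endpoints, is computed by the power `M ^ n`. -/
theorem Matrix.sum_prod_path_mul {S R : Type*} [Fintype S] [DecidableEq S] [CommSemiring R]
    (M : Matrix S S R) (n : ℕ) (K : S → S → R) :
    ∑ g : Fin (n + 1) → S, (∏ i : Fin n, M (g i.castSucc) (g i.succ)) * K (g 0) (g (Fin.last n)) =
      ∑ s, ∑ t, (M ^ n) s t * K s t := by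
  induction n generalizing K with
  | zero =>
    rw [← (Equiv.funUnique (Fin 1) S).symm.sum_comp]
    simp [Matrix.one_apply, Equiv.funUnique]
  | succ n ih =>
    rw [← (Fin.consEquiv (fun _ : Fin (n + 2) => S)).sum_comp, Fintype.sum_prod_type]
    refine Finset.sum_congr rfl fun s _ => ?_
    have h := ih fun x y => M s x * K s y
    simp only [Fin.consEquiv_apply, Fin.prod_univ_succ, Fin.castSucc_zero, Fin.cons_zero,
      Fin.cons_succ, ← Fin.succ_castSucc, ← Fin.succ_last] at h ⊢
    rw [Finset.sum_comm] at h
    calc _ = _ := Finset.sum_congr rfl fun g _ => by ring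
      _ = _ := h
      _ = _ := Finset.sum_congr rfl fun t _ => by
        rw [pow_succ', Matrix.mul_apply, Finset.sum_mul]
        exact Finset.sum_congr rfl fun x _ => by ring

/-- The trace of a power of `M` is the sum over all closed walks. -/
theorem Matrix.trace_pow_succ_eq_sum_prod {S R : Type*} [Fintype S] [DecidableEq S]
    [CommSemiring R] (M : Matrix S S R) (n : ℕ) :
    (M ^ (n + 1)).trace = ∑ g : Fin (n + 1) → S, ∏ i, M (g i) (g (i + 1)) := by
  simp only [Fin.prod_univ_castSucc, Fin.coeSucc_eq_succ, Fin.last_add_one]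
  rw [Matrix.sum_prod_path_mul M n fun s t => M t s, Matrix.trace]
  simp [pow_succ, Matrix.mul_apply]

/-- A weight on consecutive triples, viewed as a matrix indexed by pairs. -/
def pairMatrix {C R : Type*} [DecidableEq C] [Zero R] (T : C → C → C → R) :
    Matrix (C × C) (C × C) R :=
  fun s t => if s.2 = t.1 then T s.1 s.2 t.2 else 0

theorem trace_pairMatrix_pow {C R : Type*} [Fintype C] [DecidableEq C] [CommSemiring R]
    (T : C → C → C → R) (n : ℕ) :
    (pairMatrix T ^ (n + 1)).trace =
      ∑ f : Fin (n + 1) → C, ∏ i, T (f i) (f (i + 1)) (f (i + 1 + 1)) := by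
  rw [Matrix.trace_pow_succ_eq_sum_prod]
  symm
  refine Finset.sum_of_injOn (fun f i => (f i, f (i + 1))) ?_ (by simp) ?_ ?_
  · intro f _ f' _ h
    funext i
    exact congrArg Prod.fst (congrFun h i)
  · intro g _ hg
    have : ∃ i, (g i).2 ≠ (g (i + 1)).1 := by
      by_contra! h
      exact hg ⟨fun i => (g i).1, by simp, funext fun i => Prod.ext rfl (h i).symm⟩
    obtain ⟨i, hi⟩ := this
    exact Finset.prod_eq_zero (Finset.mem_univ i) (by simp [pairMatrix, hi])
  · intro f _
    simp [pairMatrix]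

/-- The number of vertices chosen in a column of the prism. -/
def colSize (c : Bool × Bool) : ℕ := c.1.toNat + c.2.toNat

/-- Both vertices of the middle one of three consecutive columns are dominated. -/
def colDominated (a b c : Bool × Bool) : Bool :=
  (b.1 || b.2 || a.1 || c.1) && (b.1 || b.2 || a.2 || c.2)

/-- The total overdomination of the middle one of three consecutive columns. -/
def colExcess (a b c : Bool × Bool) : ℕ := colSize a + 2 * colSize b + colSize c - 2

theorem colExcess_add_two (a b c : Bool × Bool) (h : colDominated a b c) :
    colExcess a b c + 2 = colSize a + 2 * colSize b + colSize c := by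
  revert a b c; decide

/-- The transfer matrix of dominating sets of the prism, graded by overdomination. -/
noncomputable def domMatrix :
    Matrix ((Bool × Bool) × (Bool × Bool)) ((Bool × Bool) × (Bool × Bool)) (Polynomial ℕ) :=
  pairMatrix fun a b c => if colDominated a b c then Polynomial.X ^ colExcess a b c else 0

/-- The action of `domMatrix` on the coefficients of a vector of polynomials. -/
def domStep (v : ℕ → (Bool × Bool) × (Bool × Bool) → ℕ) (e : ℕ)
    (s : (Bool × Bool) × (Bool × Bool)) : ℕ :=
  let term c := bif colDominated s.1 s.2 c && Nat.ble (colExcess s.1 s.2 c) e then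
    v (e - colExcess s.1 s.2 c) (s.2, c) else 0
  term (false, false) + term (false, true) + term (true, false) + term (true, true)

theorem coeff_domMatrix_pow_succ (n e : ℕ) (s t : (Bool × Bool) × (Bool × Bool)) :
    ((domMatrix ^ (n + 1)) s t).coeff e =
      domStep (fun e s => ((domMatrix ^ n) s t).coeff e) e s := by
  rw [pow_succ', Matrix.mul_apply, Fintype.sum_prod_type, Polynomial.finsetSum_coeff]
  rw [Finset.sum_eq_single s.2 (fun b _ hb => by simp [domMatrix, pairMatrix, hb.symm]) (by simp)]
  have h (b : Bool) (k : ℕ) (p : Polynomial ℕ) :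
      ((if b then Polynomial.X ^ k else 0) * p).coeff e =
        bif b && Nat.ble k e then p.coeff (e - k) else 0 := by
    cases b <;> simp [Polynomial.coeff_X_pow_mul', cond_eq_ite]
  simp only [domMatrix, pairMatrix, if_true, Fintype.sum_prod_type, Fintype.sum_bool,
    Polynomial.coeff_add, h, domStep]
  ring

theorem domStep_congr {v w : ℕ → (Bool × Bool) × (Bool × Bool) → ℕ} {e : ℕ}
    (h : ∀ e' ≤ e, ∀ s, v e' s = w e' s) (s : (Bool × Bool) × (Bool × Bool)) :
    domStep v e s = domStep w e s := by
  simp only [domStep, h _ (Nat.sub_le _ _)]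

theorem domStep_add_mul (v w : ℕ → (Bool × Bool) × (Bool × Bool) → ℕ) (k e : ℕ)
    (s : (Bool × Bool) × (Bool × Bool)) :
    domStep (fun e s => v e s + k * w e s) e s = domStep v e s + k * domStep w e s := by
  have h (b : Bool) (x y : ℕ) :
      (bif b then x + k * y else 0) = (bif b then x else 0) + k * bif b then y else 0 := by
    cases b <;> simp
  simp only [domStep, h]
  ring

/-- The table of values of a function on pairs of Booleans. -/
def pairTable {α : Type*} (f : Bool × Bool → α) : (α × α) × (α × α) :=
  ((f (false, false), f (false, true)), (f (true, false), f (true, true)))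

/-- Lookup in a table of values of a function on pairs of Booleans. -/
def pairTableGet {α : Type*} (T : (α × α) × (α × α)) (c : Bool × Bool) : α :=
  bif c.1 then (bif c.2 then T.2.2 else T.2.1) else (bif c.2 then T.1.2 else T.1.1)

theorem pairTableGet_pairTable {α : Type*} (f : Bool × Bool → α) (c : Bool × Bool) :
    pairTableGet (pairTable f) c = f c := by
  obtain ⟨_ | _, _ | _⟩ := c <;> rfl

/-- Lookup in a list, with default value zero; written with recursors so that the kernel
evaluates it quickly. -/
def listGet (l : List ℕ) (n : ℕ) : ℕ :=
  List.rec (motive := fun _ => ℕ → ℕ) (fun _ => 0)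
    (fun x _ ih n => Nat.rec x (fun n _ => ih n) n) l n

/-- The table of the coefficients of degree less than five of a vector of polynomials. -/
def domTableOf (v : ℕ → (Bool × Bool) × (Bool × Bool) → ℕ) :=
  pairTable fun a => pairTable fun b =>
    [v 0 (a, b), v 1 (a, b), v 2 (a, b), v 3 (a, b), v 4 (a, b)]

/-- The powers of `domMatrix`, one column at a time, as tables of coefficients. -/
def domTable (t : (Bool × Bool) × (Bool × Bool)) (n : ℕ) :=
  (fun T => domTableOf (domStep fun e s => listGet (pairTableGet (pairTableGet T s.1) s.2) e))^[n]
    (domTableOf fun e s => if s = t ∧ e = 0 then 1 else 0)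

/-- The entries of `domTable`. -/
def domCoeff (t : (Bool × Bool) × (Bool × Bool)) (n e : ℕ) (s : (Bool × Bool) × (Bool × Bool)) :
    ℕ :=
  listGet (pairTableGet (pairTableGet (domTable t n) s.1) s.2) e

theorem listGet_domTableOf (v : ℕ → (Bool × Bool) × (Bool × Bool) → ℕ) {e : ℕ} (he : e < 5)
    (s : (Bool × Bool) × (Bool × Bool)) :
    listGet (pairTableGet (pairTableGet (domTableOf v) s.1) s.2) e = v e s := by
  simp only [domTableOf, pairTableGet_pairTable]
  interval_cases e <;> rfl

theorem coeff_domMatrix_pow (n : ℕ) {e : ℕ} (he : e < 5) (s t : (Bool × Bool) × (Bool × Bool)) :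
    ((domMatrix ^ n) s t).coeff e = domCoeff t n e s := by
  induction n generalizing e s with
  | zero =>
    rw [domCoeff, domTable, Function.iterate_zero, id, listGet_domTableOf _ he, pow_zero,
      Matrix.one_apply]
    by_cases h : s = t <;> simp [h, Polynomial.coeff_one]
  | succ n ih =>
    rw [domCoeff, domTable, Function.iterate_succ_apply', listGet_domTableOf _ he,
      coeff_domMatrix_pow_succ]
    exact domStep_congr (fun e' he' s => ih (he'.trans_lt he) s) s

/-- The number of dominating sets of the prism over an `n`-cycle with total overdomination `e`,
for `e = 0, 2, 4`. -/
def domCount (n e : ℕ) : ℕ :=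
  if e = 0 then if n % 4 = 0 then 4 else 0
  else if e = 2 then if n % 2 = 1 then 2 * n + (if n = 3 then 3 else 0) else 0
  else if e = 4 then if n % 2 = 0 then n * (n + 2) + (if n = 6 then 3 else 0) else 0
  else 0

/-- The list of all pairs of columns. -/
def colPairs : List ((Bool × Bool) × (Bool × Bool)) :=
  let l := [(false, false), (false, true), (true, false), (true, true)]
  l.product l

theorem mem_colPairs (s : (Bool × Bool) × (Bool × Bool)) : s ∈ colPairs := by
  revert s; decide

theorem sum_colPairs (F : (Bool × Bool) × (Bool × Bool) → ℕ) : (colPairs.map F).sum = ∑ s, F s := by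
  simp [colPairs, List.product, Fintype.sum_prod_type]
  ring

theorem domCoeff_check :
    ((colPairs.all fun t => colPairs.all fun s => (List.range 5).all fun e =>
        Nat.beq (domCoeff t 21 e s + 3 * domCoeff t 13 e s)
          (domCoeff t 9 e s + 3 * domCoeff t 17 e s)) &&
      (List.range 18).all fun n => [0, 2, 4].all fun e =>
        Nat.beq (colPairs.map fun t => domCoeff t (n + 3) e t).sum (domCount (n + 3) e)) = true := by
  decide +kernel

theorem coeff_domMatrix_pow_rec (n : ℕ) {e : ℕ} (he : e < 5)
    (s t : (Bool × Bool) × (Bool × Bool)) :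
    ((domMatrix ^ (n + 21)) s t).coeff e + 3 * ((domMatrix ^ (n + 13)) s t).coeff e =
      ((domMatrix ^ (n + 9)) s t).coeff e + 3 * ((domMatrix ^ (n + 17)) s t).coeff e := by
  induction n generalizing e s with
  | zero =>
    have h := domCoeff_check
    simp only [Bool.and_eq_true, List.all_eq_true, Nat.beq_eq] at h
    simpa only [zero_add, coeff_domMatrix_pow _ he] using
      h.1 t (mem_colPairs t) s (mem_colPairs s) e (List.mem_range.2 he)
  | succ n ih =>
    rw [Nat.add_right_comm n 1, Nat.add_right_comm n 1, Nat.add_right_comm n 1,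
      Nat.add_right_comm n 1, coeff_domMatrix_pow_succ (n + 21), coeff_domMatrix_pow_succ (n + 13),
      coeff_domMatrix_pow_succ (n + 9), coeff_domMatrix_pow_succ (n + 17),
      ← domStep_add_mul, ← domStep_add_mul]
    exact domStep_congr (fun e' he' s => ih (he'.trans_lt he) s) s

theorem coeff_trace_domMatrix_pow {n e : ℕ} (hn : 3 ≤ n) (he : e = 0 ∨ e = 2 ∨ e = 4) :
    (domMatrix ^ n).trace.coeff e = domCount n e := by
  have he5 : e < 5 := by lia
  induction n using Nat.strong_induction_on with
  | _ n ih =>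
  by_cases h21 : n < 21
  · have h := domCoeff_check
    simp only [Bool.and_eq_true, List.all_eq_true, Nat.beq_eq] at h
    have := h.2 (n - 3) (List.mem_range.2 (by lia)) e (by simpa using he)
    rw [Nat.sub_add_cancel hn, sum_colPairs] at this
    simpa only [Matrix.trace, Matrix.diag, Polynomial.finsetSum_coeff,
      coeff_domMatrix_pow _ he5] using this
  · obtain ⟨k, rfl⟩ : ∃ k, n = k + 21 := ⟨n - 21, by lia⟩
    have h : (domMatrix ^ (k + 21)).trace.coeff e + 3 * (domMatrix ^ (k + 13)).trace.coeff e =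
        (domMatrix ^ (k + 9)).trace.coeff e + 3 * (domMatrix ^ (k + 17)).trace.coeff e := by
      simp only [Matrix.trace, Matrix.diag, Polynomial.finsetSum_coeff, Finset.mul_sum,
        ← Finset.sum_add_distrib, coeff_domMatrix_pow_rec k he5]
    rw [ih (k + 13) (by lia) (by lia), ih (k + 9) (by lia) (by lia),
      ih (k + 17) (by lia) (by lia)] at h
    simp only [domCount] at h ⊢
    have h9 : k + 9 ≠ 3 ∧ k + 9 ≠ 6 ∧ k + 13 ≠ 3 ∧ k + 13 ≠ 6 ∧ k + 17 ≠ 3 ∧ k + 17 ≠ 6 ∧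
      k + 21 ≠ 3 ∧ k + 21 ≠ 6 := by lia
    have h4 : (k + 9) % 4 = (k + 21) % 4 ∧ (k + 13) % 4 = (k + 21) % 4 ∧
      (k + 17) % 4 = (k + 21) % 4 := by lia
    have h2 : (k + 9) % 2 = (k + 21) % 2 ∧ (k + 13) % 2 = (k + 21) % 2 ∧
      (k + 17) % 2 = (k + 21) % 2 := by lia
    simp only [h9, h4, h2, if_false] at h ⊢
    obtain rfl | rfl | rfl := he
    · simp only [if_true] at h ⊢
      lia
    · simp only [if_true, OfNat.ofNat_ne_zero, if_false] at h ⊢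
      split_ifs at h ⊢ <;> lia
    · norm_num at h ⊢
      split_ifs at h ⊢ <;> nlinarith

theorem card_filter_dominated_eq_coeff (n e : ℕ) :
    #{f : Fin (n + 1) → Bool × Bool | (∀ i, colDominated (f i) (f (i + 1)) (f (i + 1 + 1))) ∧
        ∑ i, colExcess (f i) (f (i + 1)) (f (i + 1 + 1)) = e} =
      (domMatrix ^ (n + 1)).trace.coeff e := by
  rw [domMatrix, trace_pairMatrix_pow, Polynomial.finsetSum_coeff, Finset.card_filter]
  refine Finset.sum_congr rfl fun f _ => ?_
  rw [Finset.prod_ite_zero, Finset.prod_pow_eq_pow_sum]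
  by_cases h : ∀ i, colDominated (f i) (f (i + 1)) (f (i + 1 + 1))
  · simp [h, Polynomial.coeff_X_pow, eq_comm]
  · simp [h]

/-- A set of vertices of the prism, as a sequence of columns. -/
def columnsEquiv (n : ℕ) : (Fin n → Bool × Bool) ≃ Finset (Fin 2 × Fin n) where
  toFun f := {p | (if p.1 = 0 then (f p.2).1 else (f p.2).2) = true}
  invFun D i := (decide ((0, i) ∈ D), decide ((1, i) ∈ D))
  left_inv f := by funext i; simp
  right_inv D := by
    ext ⟨j, i⟩
    fin_cases j <;> simp

theorem mem_columnsEquiv {n : ℕ} (f : Fin n → Bool × Bool) (j : Fin 2) (i : Fin n) :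
    (j, i) ∈ columnsEquiv n f ↔ (if j = 0 then (f i).1 else (f i).2) = true := by
  simp [columnsEquiv]

theorem card_columnsEquiv {n : ℕ} (f : Fin n → Bool × Bool) :
    #(columnsEquiv n f) = ∑ i, colSize (f i) := by
  have h (b : Bool) : (if b = true then 1 else 0) = b.toNat := by cases b <;> rfl
  simp only [columnsEquiv, Equiv.coe_fn_mk, Finset.card_filter, Fintype.sum_prod_type,
    Fin.sum_univ_two, colSize, Finset.sum_add_distrib, h, if_true, one_ne_zero, if_false]

theorem isDomSet_columnsEquiv {m : ℕ} (f : Fin (m + 3) → Bool × Bool) :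
    isDomSet (pathGraph 2 □ cycleGraph (m + 3)) (columnsEquiv (m + 3) f) ↔
      ∀ i, colDominated (f i) (f (i + 1)) (f (i + 1 + 1)) := by
  have hpath (a j : Fin 2) : (pathGraph 2).Adj a j ↔ a ≠ j := by
    revert a j; simp [pathGraph_adj, Fin.forall_fin_two]
  have hcycle (b i : Fin (m + 3)) :
      (cycleGraph (m + 3)).Adj b (i + 1) ↔ b = i ∨ b = i + 1 + 1 := by
    rw [cycleGraph_adj (n := m + 1), sub_eq_iff_eq_add', sub_eq_iff_eq_add',
      add_left_inj, or_comm, eq_comm (a := i)]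
  have key (j : Fin 2) (i : Fin (m + 3)) :
      ((j, i + 1) ∉ columnsEquiv (m + 3) f → ∃ u ∈ columnsEquiv (m + 3) f,
        (pathGraph 2 □ cycleGraph (m + 3)).Adj u (j, i + 1)) ↔
      ((0, i + 1) ∈ columnsEquiv (m + 3) f ∨ (1, i + 1) ∈ columnsEquiv (m + 3) f ∨
        (j, i) ∈ columnsEquiv (m + 3) f ∨ (j, i + 1 + 1) ∈ columnsEquiv (m + 3) f) := by
    simp only [boxProd_adj, Prod.exists, hpath, hcycle, Fin.exists_fin_two]
    fin_cases j <;> simp [and_or_left, exists_or] <;> tauto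
  have hall : isDomSet (pathGraph 2 □ cycleGraph (m + 3)) (columnsEquiv (m + 3) f) ↔
      ∀ i j, (j, i + 1) ∉ columnsEquiv (m + 3) f → ∃ u ∈ columnsEquiv (m + 3) f,
        (pathGraph 2 □ cycleGraph (m + 3)).Adj u (j, i + 1) :=
    ⟨fun h i j => h (j, i + 1), fun h v => by simpa using h (v.2 - 1) v.1⟩
  rw [hall]
  refine forall_congr' fun i => ?_
  rw [Fin.forall_fin_two, key, key]
  simp only [mem_columnsEquiv, colDominated, Bool.and_eq_true, Bool.or_eq_true, if_true,
    one_ne_zero, if_false, or_assoc]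

theorem four_mul_card_columnsEquiv {n : ℕ} (f : Fin (n + 1) → Bool × Bool)
    (h : ∀ i, colDominated (f i) (f (i + 1)) (f (i + 1 + 1))) :
    ∑ i, colExcess (f i) (f (i + 1)) (f (i + 1 + 1)) + 2 * (n + 1) =
      4 * #(columnsEquiv (n + 1) f) := by
  have h1 : ∑ i, colSize (f (i + 1)) = ∑ i, colSize (f i) :=
    Equiv.sum_comp (Equiv.addRight (1 : Fin (n + 1))) fun i => colSize (f i)
  have h2 : ∑ i, colSize (f (i + 1 + 1)) = ∑ i, colSize (f (i + 1)) :=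
    Equiv.sum_comp (Equiv.addRight (1 : Fin (n + 1))) fun i => colSize (f (i + 1))
  have h3 := Finset.sum_congr (rfl : (univ : Finset (Fin (n + 1))) = univ)
    fun i _ => colExcess_add_two _ _ _ (h i)
  simp only [Finset.sum_add_distrib, ← Finset.mul_sum, h2, h1, Finset.sum_const,
    Finset.card_univ, Fintype.card_fin, smul_eq_mul] at h3
  rw [card_columnsEquiv]
  lia

theorem card_isDomSet_prism {m k e : ℕ} (h : 4 * k = e + 2 * (m + 3)) :
    #{D : Finset (Fin 2 × Fin (m + 3)) |
      isDomSet (pathGraph 2 □ cycleGraph (m + 3)) D ∧ #D = k} =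
    (domMatrix ^ (m + 3)).trace.coeff e := by
  rw [← card_filter_dominated_eq_coeff]
  symm
  refine Finset.card_equiv (columnsEquiv (m + 3)) fun f => ?_
  simp only [Finset.mem_filter, Finset.mem_univ, true_and, isDomSet_columnsEquiv]
  refine and_congr_right fun hf => ?_
  have := four_mul_card_columnsEquiv f hf
  lia

theorem two_mul_le_four_mul_card_of_isDomSet {m : ℕ} {D : Finset (Fin 2 × Fin (m + 3))}
    (h : isDomSet (pathGraph 2 □ cycleGraph (m + 3)) D) : 2 * (m + 3) ≤ 4 * #D := by
  obtain ⟨f, rfl⟩ := (columnsEquiv (m + 3)).surjective D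
  have := four_mul_card_columnsEquiv f ((isDomSet_columnsEquiv f).1 h)
  lia

theorem tau_eq_of_domNum {V : Type*} [Fintype V] {G : SimpleGraph V} {k : ℕ}
    (hlt : ∀ D : Finset V, isDomSet G D → k ≤ #D)
    (hpos : 0 < #{D : Finset V | isDomSet G D ∧ #D = k}) :
    tau G = #{D : Finset V | isDomSet G D ∧ #D = k} := by
  obtain ⟨D, hD⟩ := Finset.card_pos.1 hpos
  have hk : domNum G = k := by
    refine le_antisymm (Nat.sInf_le ⟨D, by simpa using hD⟩) ?_
    refine le_csInf ⟨k, D, by simpa using hD⟩ ?_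
    rintro _ ⟨D', hD', rfl⟩
    exact hlt D' hD'
  rw [tau, gammaSets, hk]

theorem tau_prism {m k e : ℕ} (h : 4 * k = e + 2 * (m + 3)) (he : e = 0 ∨ e = 2 ∨ e = 4)
    (h0 : e = 4 → (m + 3) % 4 ≠ 0) (hpos : 0 < domCount (m + 3) e) :
    tau (pathGraph 2 □ cycleGraph (m + 3)) = domCount (m + 3) e := by
  have hc := card_isDomSet_prism h
  rw [coeff_trace_domMatrix_pow (by lia) he] at hc
  rw [← hc] at hpos ⊢
  refine tau_eq_of_domNum (fun D hD => ?_) hpos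
  by_contra! hlt
  have hle := two_mul_le_four_mul_card_of_isDomSet hD
  have hc' := card_isDomSet_prism (m := m) (k := #D) (e := 0) (by lia)
  rw [coeff_trace_domMatrix_pow (by lia) (Or.inl rfl)] at hc'
  have : (m + 3) % 4 ≠ 0 := h0 (by lia)
  rw [domCount, if_pos rfl, if_neg this, Finset.card_eq_zero] at hc'
  exact Finset.notMem_empty D (hc' ▸ by simpa using hD)

theorem tau_P2_boxProd_Cn (n : ℕ) (hn : 3 ≤ n) :
    tau (pathGraph 2 □ cycleGraph n) =
      if n = 3 then 9
      else if n = 6 then 51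
      else if n % 4 = 0 then 4
      else if n % 4 = 2 then n * (n + 2)
      else 2 * n := by
  obtain ⟨m, rfl⟩ : ∃ m, n = m + 3 := ⟨n - 3, by lia⟩
  have hmod : (m + 3) % 4 = 0 ∨ (m + 3) % 4 = 2 ∨ (m + 3) % 2 = 1 := by lia
  obtain h | h | h := hmod
  · rw [tau_prism (k := (m + 3) / 2) (e := 0) (by lia) (by simp) (by simp) (by simp [domCount, h])]
    have : m + 3 ≠ 3 ∧ m + 3 ≠ 6 := by lia
    simp only [domCount, h, this, if_true, if_false]
  · have h2 : (m + 3) % 2 = 0 := by lia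
    rw [tau_prism (k := (m + 3) / 2 + 1) (e := 4) (by lia) (by simp) (by lia)
      (by simp [domCount, h2])]
    have : m ≠ 0 := by lia
    by_cases h6 : m + 3 = 6
    · simp [domCount, h6]
    · simp [domCount, h, h2, h6, this]
  · have h4 : (m + 3) % 4 ≠ 0 ∧ (m + 3) % 4 ≠ 2 ∧ m + 3 ≠ 6 := by lia
    rw [tau_prism (k := (m + 4) / 2) (e := 2) (by lia) (by simp) (by simp)
      (by simp [domCount, h])]
    by_cases h3 : m + 3 = 3
    · simp [domCount, h3]
    · simp only [domCount, h, h4, h3, if_true, if_false]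
      simp
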